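/- arXiv:2203.00856 — 4 statements merged into one kernel-verified Lean document; each statement's English description precedes it below -/
import Mathlib

section
/- Let G be a finite group, σ an automorphism of G with σ∘σ = id, g ≥ 1 and k ≥ 1 integers, and C₁,…,C_k conjugacy classes of G. Then the number of tuples (A₁,B₁,…,A_g,B_g,X₁,…,X_k) ∈ G^{2g} × C₁×⋯×C_k satisfying A₁·σ(B₁)·A₁⁻¹·B₁⁻¹ · ∏_{i=2}^{g}[A_i,B_i] · X₁⋯X_k = 1 (where [A,B] = ABA⁻¹B⁻¹) is equal to |G| · Σ_χ (|G|/χ(1))^{2g-2} · ∏_{j=1}^{k} |C_j|·χ(C_j)/χ(1), where the sum runs over all σ-stable irreducible complex characters χ of G. -/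
open CategoryTheory

theorem FDRep.simple_of_isIrreducible {G : Type} [Group G] [Fintype G] {V : Type} [AddCommGroup V]
    [Module ℂ V] [Module.Finite ℂ V] (ρ : Representation ℂ G V) [ρ.IsIrreducible] :
    Simple (FDRep.of ρ) := by
  have := invertibleOfNonzero (NeZero.ne (Nat.card G : ℂ))
  rw [FDRep.simple_iff_char_is_norm_one]
  have h := Representation.char_orthonormal ρ ρ
  rw [if_pos ⟨Representation.Equiv.refl _⟩, inv_mul_eq_one₀ (NeZero.ne _)] at h
  exact h.symm

open MonoidAlgebra in
theorem smul_eq_zero_of_asAlgebraHom_eq_zero {G : Type} [Group G] [Fintype G] {M : Type}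
    [AddCommGroup M] [Module ℂ M] [Module ℂ[G] M] [IsScalarTower ℂ ℂ[G] M] [IsSimpleModule ℂ[G] M]
    (z : ℂ[G]) (hz : ∀ W : FDRep ℂ G, Simple W → Representation.asAlgebraHom W.ρ z = 0) (m : M) :
    z • m = 0 := by
  set ρ := Representation.ofModule' (k := ℂ) (G := G) M
  have hρ : Representation.asAlgebraHom ρ = Algebra.lsmul ℂ ℂ M :=
    (MonoidAlgebra.lift ℂ (M →ₗ[ℂ] M) G).apply_symm_apply _
  let e : ρ.asModule ≃ₗ[ℂ[G]] M :=
    { ρ.asModuleEquiv with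
      map_smul' := fun r x ↦ by
        simp [hρ] }
  have : ρ.IsIrreducible :=
    ρ.irreducible_iff_isSimpleModule_asModule.mpr (IsSimpleModule.congr e)
  have : Module.Finite ℂ M := Module.Finite.trans ℂ[G] _
  have h := LinearMap.congr_fun (hz _ (FDRep.simple_of_isIrreducible ρ)) m
  rw [FDRep.of_ρ'] at h
  exact (LinearMap.congr_fun (DFunLike.congr_fun hρ z) m).symm.trans h

open MonoidAlgebra in
theorem FDRep.eq_zero_of_asAlgebraHom_eq_zero {G : Type} [Group G] [Fintype G] (z : ℂ[G])
    (hz : ∀ W : FDRep ℂ G, Simple W → Representation.asAlgebraHom W.ρ z = 0) : z = 0 := by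
  have h : z ∈ Ring.jacobson ℂ[G] := by
    refine Ideal.mem_sInf.mpr fun {I} hI ↦ ?_
    have : IsSimpleModule ℂ[G] (ℂ[G] ⧸ I) := isSimpleModule_iff_isCoatom.mpr hI
    have h := smul_eq_zero_of_asAlgebraHom_eq_zero z hz (Submodule.Quotient.mk (p := I) 1)
    rwa [← Submodule.Quotient.mk_smul, Submodule.Quotient.mk_eq_zero, smul_eq_mul, mul_one] at h
  simpa [IsSemisimpleRing.jacobson_eq_bot] using h

theorem FDRep.character_one_ne_zero {G : Type} [Group G] (V : FDRep ℂ G) [Simple V] :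
    V.character 1 ≠ 0 := by
  intro h
  rw [FDRep.char_one, Nat.cast_eq_zero] at h
  have hs : Subsingleton V := Module.finrank_zero_iff.mp h
  apply id_nonzero V
  ext x
  exact hs.elim _ _

theorem FDRep.eq_smul_id_of_commute {G : Type} [Group G] (V : FDRep ℂ G) [Simple V]
    (T : V →ₗ[ℂ] V) (hT : ∀ x, T ∘ₗ V.ρ x = V.ρ x ∘ₗ T) :
    T = (LinearMap.trace ℂ V T / V.character 1) • 1 := by
  let f : V ⟶ V := ⟨InducedCategory.homMk (ModuleCat.ofHom T), fun g ↦ by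
    ext1; ext1
    exact LinearMap.congr_fun (hT g) _⟩
  obtain ⟨c, hc⟩ := endomorphism_simple_eq_smul_id ℂ f
  have hc : T = c • 1 := (congrArg (fun f : V ⟶ V ↦ f.hom.hom.hom) hc).symm
  rw [hc, map_smul, LinearMap.trace_one, smul_eq_mul, FDRep.char_one, mul_div_cancel_right₀]
  simpa [FDRep.char_one] using V.character_one_ne_zero

theorem sum_prod_finRange {R : Type*} [Semiring R] : ∀ {n : ℕ} {α : Fin n → Type} [∀ i, Fintype (α i)]
    (f : ∀ i, α i → R),
    ∑ p : (∀ i, α i), ((List.finRange n).map fun i ↦ f i (p i)).prod =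
      ((List.finRange n).map fun i ↦ ∑ a, f i a).prod
  | 0, α, _, f => by simp
  | n + 1, α, _, f => by
    rw [← (Fin.consEquiv α).sum_comp, Fintype.sum_prod_type]
    simp only [List.finRange_succ, List.map_cons, List.map_map, List.prod_cons, Function.comp_def,
      Fin.consEquiv_apply, Fin.cons_zero, Fin.cons_succ]
    rw [← sum_prod_finRange, Finset.sum_mul_sum]

section

variable {G : Type} [Group G] [Fintype G] (V : FDRep ℂ G) [Simple V]

theorem FDRep.sum_smul_of_conj_invariant (f : G → ℂ) (hf : ∀ h x, f (h * x * h⁻¹) = f x) :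
    ∑ x, f x • V.ρ x = ((∑ x, f x * V.character x) / V.character 1) • 1 := by
  have key := V.eq_smul_id_of_commute (∑ x, f x • V.ρ x) fun h ↦ by
    simp only [← Module.End.mul_eq_comp, Finset.sum_mul, Finset.mul_sum, smul_mul_assoc,
      mul_smul_comm, ← map_mul]
    refine Fintype.sum_equiv (MulAut.conj h⁻¹).toEquiv _ _ fun x ↦ ?_
    have := hf h⁻¹ x
    simp_all [mul_assoc]
  simpa [FDRep.character] using key

theorem FDRep.sum_rho_conj (y : G) :
    ∑ a, V.ρ (a * y * a⁻¹) = (Fintype.card G * V.character y / V.character 1) • 1 := by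
  have key := V.eq_smul_id_of_commute (∑ a, V.ρ (a * y * a⁻¹)) fun h ↦ by
    simp only [← Module.End.mul_eq_comp, Finset.sum_mul, Finset.mul_sum, ← map_mul]
    refine Fintype.sum_equiv (Equiv.mulLeft h⁻¹) _ _ fun x ↦ ?_
    simp [mul_assoc]
  rw [key, map_sum]
  change ((∑ a, V.character (a * y * a⁻¹)) / V.character 1) • _ = _
  simp [FDRep.char_conj]

open scoped Classical in
theorem FDRep.sum_character_mul_inv (W : FDRep ℂ G) [Simple W] :
    ∑ x, V.character x * W.character x⁻¹ = if Nonempty (V ≅ W) then (Fintype.card G : ℂ) else 0 := by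
  have := invertibleOfNonzero (NeZero.ne (Nat.card G : ℂ))
  have h := FDRep.char_orthonormal V W
  rw [inv_mul_eq_iff_eq_mul₀ (NeZero.ne _)] at h
  rw [h]
  simp

open scoped Classical in
theorem FDRep.sum_character_twist (τ : G ≃* G) :
    ∑ x, V.character (τ x) * V.character x⁻¹ =
      if ∀ x, V.character (τ x) = V.character x then (Fintype.card G : ℂ) else 0 := by
  have hVV := V.sum_character_mul_inv V
  rw [if_pos ⟨Iso.refl V⟩] at hVV
  split_ifs with h
  · simpa only [h] using hVV
  · let W : FDRep ℂ G := FDRep.of (V.ρ.comp τ.toMonoidHom)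
    have hW : ∀ x, W.character x = V.character (τ x) := fun x ↦ rfl
    have : Simple W := by
      rw [FDRep.simple_iff_char_is_norm_one, Nat.card_eq_fintype_card, ← hVV,
        ← τ.toEquiv.sum_comp fun x ↦ V.character x * V.character x⁻¹]
      simp [hW]
    have h2 := W.sum_character_mul_inv V
    rw [if_neg fun ⟨e⟩ ↦ h fun x ↦ congrFun (FDRep.char_iso e) x] at h2
    exact h2

open scoped Classical in
theorem FDRep.sum_rho_twisted_commutator (τ : G ≃* G) :
    ∑ p : G × G, V.ρ (p.1 * τ p.2 * p.1⁻¹ * p.2⁻¹) =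
      (if ∀ x, V.character (τ x) = V.character x then
        ((Fintype.card G : ℂ) / V.character 1) ^ 2 else 0) • 1 := by
  have h := V.sum_smul_of_conj_invariant (fun b ↦ V.character (τ b⁻¹)) fun h x ↦ by
    simp [← mul_assoc, FDRep.char_conj]
  have h3 : ∑ x, V.character (τ x⁻¹) * V.character x =
      if ∀ x, V.character (τ x) = V.character x then (Fintype.card G : ℂ) else 0 := by
    rw [← V.sum_character_twist τ,
      ← Equiv.sum_comp (Equiv.inv G) fun x ↦ V.character (τ x⁻¹) * V.character x]
    simp
  rw [h3, ← Equiv.sum_comp (Equiv.inv G) fun x ↦ V.character (τ x⁻¹) • V.ρ x] at h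
  simp only [Equiv.inv_apply, inv_inv] at h
  simp_rw [Fintype.sum_prod_type_right, map_mul V.ρ _ (_⁻¹ : G)]
  have h4 : ∀ b, ∑ a, V.ρ (a * τ b * a⁻¹) * V.ρ b⁻¹ =
      ((Fintype.card G : ℂ) / V.character 1) • V.character (τ b) • V.ρ b⁻¹ := fun b ↦ by
    rw [← Finset.sum_mul, V.sum_rho_conj, smul_mul_assoc, one_mul, smul_smul]
    congr 1
    ring
  simp_rw [← map_mul V.ρ, mul_assoc] at h4 ⊢
  simp_rw [h4, ← Finset.smul_sum, h, smul_smul]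
  congr 1
  split_ifs <;> ring

theorem FDRep.sum_rho_conjClass (c : G) [Fintype {x // IsConj c x}] :
    ∑ x : {x // IsConj c x}, V.ρ x =
      (Nat.card {x // IsConj c x} * V.character c / V.character 1) • 1 := by
  classical
  have h := V.sum_smul_of_conj_invariant (fun x ↦ if IsConj c x then 1 else 0) fun h x ↦ by
    have : IsConj x (h * x * h⁻¹) := isConj_iff.mpr ⟨h, rfl⟩
    simp only [show IsConj c (h * x * h⁻¹) ↔ IsConj c x from
      ⟨fun h ↦ h.trans this.symm, fun h ↦ h.trans this⟩]
  simp only [ite_smul, one_smul, zero_smul, ite_mul, one_mul, zero_mul, ← Finset.sum_filter] at h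
  rw [← Finset.sum_subtype (Finset.univ.filter fun x ↦ IsConj c x) (by simp) fun x ↦ V.ρ x, h]
  have h2 : ∀ x ∈ Finset.univ.filter fun x ↦ IsConj c x, V.character x = V.character c := by
    intro x hx
    obtain ⟨y, rfl⟩ := isConj_iff.mp (Finset.mem_filter.mp hx).2
    exact V.char_conj _ _
  rw [Finset.sum_congr rfl h2, Finset.sum_const, nsmul_eq_mul, Nat.card_eq_fintype_card,
    Fintype.card_subtype]

end

section

variable {G : Type} [Group G] [Fintype G] {ι : Type} [Fintype ι] (V : ι → FDRep ℂ G)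

open scoped Classical in
theorem FDRep.sum_character_one_mul_character
    (hsimple : ∀ i, Simple (V i))
    (hdistinct : ∀ i j : ι, Nonempty (V i ≅ V j) → i = j)
    (hcomplete : ∀ W : FDRep ℂ G, Simple W → ∃ i : ι, Nonempty (V i ≅ W)) (x : G) :
    ∑ i, (V i).character 1 * (V i).character x = if x = 1 then (Fintype.card G : ℂ) else 0 := by
  have key := FDRep.eq_zero_of_asAlgebraHom_eq_zero
    (∑ x, MonoidAlgebra.single x (∑ i, (V i).character 1 * (V i).character x⁻¹) -
      MonoidAlgebra.single 1 (Fintype.card G : ℂ)) fun W hW ↦ by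
    obtain ⟨j, ⟨e⟩⟩ := hcomplete W hW
    have hi : ∀ i, Nonempty (W ≅ V i) ↔ i = j := fun i ↦
      ⟨fun ⟨e'⟩ ↦ (hdistinct _ _ ⟨e ≪≫ e'⟩).symm, fun h ↦ h ▸ ⟨e.symm⟩⟩
    have h := W.sum_smul_of_conj_invariant
      (fun x ↦ ∑ i, (V i).character 1 * (V i).character x⁻¹) fun h x ↦ by
        simp [← mul_assoc, FDRep.char_conj]
    simp only [map_sub, map_sum, Representation.asAlgebraHom_single, map_one]
    rw [h]
    have h2 : ∑ x, (∑ i, (V i).character 1 * (V i).character x⁻¹) * W.character x =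
        W.character 1 * Fintype.card G := by
      simp_rw [Finset.sum_mul]
      rw [Finset.sum_comm]
      have : ∀ i, ∑ x, (V i).character 1 * (V i).character x⁻¹ * W.character x =
          (V i).character 1 * if i = j then (Fintype.card G : ℂ) else 0 := fun i ↦ by
        rw [← if_congr (hi i) rfl rfl, ← FDRep.sum_character_mul_inv, Finset.mul_sum]
        exact Finset.sum_congr rfl fun x _ ↦ by ring
      simp only [this, mul_ite, mul_zero, Finset.sum_ite_eq', Finset.mem_univ, if_true,
        FDRep.char_iso e]
    rw [h2, mul_div_cancel_left₀ _ W.character_one_ne_zero, sub_self]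
  have h := congrArg (fun z ↦ z.coeff x⁻¹) (sub_eq_zero.mp key)
  simpa [MonoidAlgebra.coeff_sum, Finsupp.single_apply, eq_comm, -FDRep.char_one] using h

end

theorem FDRep.sum_rho_prod_finRange {G : Type} [Group G] (V : FDRep ℂ G) {n : ℕ} {α : Fin n → Type}
    [∀ i, Fintype (α i)] (f : ∀ i, α i → G) (s : Fin n → ℂ)
    (hs : ∀ i, ∑ a, V.ρ (f i a) = s i • 1) :
    ∑ p : (∀ i, α i), V.ρ ((List.finRange n).map fun i ↦ f i (p i)).prod = (∏ i, s i) • 1 := by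
  simp_rw [map_list_prod, List.map_map, Function.comp_def]
  rw [sum_prod_finRange fun i a ↦ V.ρ (f i a)]
  simp_rw [hs, ← Algebra.algebraMap_eq_smul_one]
  rw [← List.ofFn_eq_map, ← List.prod_ofFn, map_list_prod, List.map_ofFn, Function.comp_def]

open scoped Classical in
/-- Frobenius-type formula: for a finite group `G`, an automorphism `σ` of `G` with `σ∘σ = id`,
integers `g ≥ 1`, `k ≥ 1`, and conjugacy classes `C₁,…,C_k` (with representatives `c j`），the
number of tuples `(Aᵢ,Bᵢ)_{i≤g}, (Xⱼ)_{j≤k}` with `Xⱼ ∈ Cⱼ` and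
`A₁σ(B₁)A₁⁻¹B₁⁻¹·∏_{i=2}^g [Aᵢ,Bᵢ]·X₁⋯X_k = 1` equals
`|G|·Σ_χ (|G|/χ(1))^{2g-2}·∏ⱼ |Cⱼ|χ(Cⱼ)/χ(1)`, the sum being over the σ-stable irreducible
complex characters of `G`.  The irreducible representations of `G` are encoded by a complete
family `(V i)` of pairwise non-isomorphic simple objects of `FDRep ℂ G`. -/
theorem frobenius_formula_twisted
    {G : Type} [Group G] [Fintype G]
    (σ : G ≃* G) (hσ : ∀ x, σ (σ x) = x)
    (g k : ℕ) (hg : 1 ≤ g) (hk : 1 ≤ k)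
    (c : Fin k → G)
    (ι : Type) [Fintype ι] (V : ι → FDRep ℂ G)
    (hsimple : ∀ i, Simple (V i))
    (hdistinct : ∀ i j : ι, Nonempty (V i ≅ V j) → i = j)
    (hcomplete : ∀ W : FDRep ℂ G, Simple W → ∃ i : ι, Nonempty (V i ≅ W)) :
    (Nat.card {p : (Fin g → G × G) × (Fin k → G) //
        (∀ j : Fin k, IsConj (c j) (p.2 j)) ∧
        (p.1 ⟨0, hg⟩).1 * σ (p.1 ⟨0, hg⟩).2 * (p.1 ⟨0, hg⟩).1⁻¹ * (p.1 ⟨0, hg⟩).2⁻¹ *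
            (((List.finRange g).drop 1).map
              (fun i => (p.1 i).1 * (p.1 i).2 * (p.1 i).1⁻¹ * (p.1 i).2⁻¹)).prod *
            ((List.finRange k).map (fun j => p.2 j)).prod = 1} : ℂ)
      = (Fintype.card G : ℂ) *
          ∑ i : ι,
            if ∀ x : G, (V i).character (σ x) = (V i).character x then
              ((Fintype.card G : ℂ) / (V i).character 1) ^ (2 * g - 2) *
                ∏ j : Fin k,
                  (Nat.card {x : G // IsConj (c j) x} : ℂ) * (V i).character (c j) /
                    (V i).character 1
            else 0 := by
  obtain ⟨n, rfl⟩ : ∃ n, g = n + 1 := ⟨g - 1, by omega⟩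
  let τ : Fin (n + 1) → (G ≃* G) := Fin.cons σ fun _ ↦ MulEquiv.refl G
  let w₁ : (Fin (n + 1) → G × G) → G := fun p ↦
    ((List.finRange (n + 1)).map fun i ↦ (p i).1 * τ i (p i).2 * (p i).1⁻¹ * (p i).2⁻¹).prod
  let w₂ : (∀ j, {x : G // IsConj (c j) x}) → G := fun q ↦
    ((List.finRange k).map fun j ↦ (q j : G)).prod
  let e : {p : (Fin (n + 1) → G × G) × (Fin k → G) //
      (∀ j : Fin k, IsConj (c j) (p.2 j)) ∧
      (p.1 ⟨0, hg⟩).1 * σ (p.1 ⟨0, hg⟩).2 * (p.1 ⟨0, hg⟩).1⁻¹ * (p.1 ⟨0, hg⟩).2⁻¹ *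
          (((List.finRange (n + 1)).drop 1).map
            (fun i => (p.1 i).1 * (p.1 i).2 * (p.1 i).1⁻¹ * (p.1 i).2⁻¹)).prod *
          ((List.finRange k).map (fun j => p.2 j)).prod = 1} ≃
      {p : (Fin (n + 1) → G × G) × (∀ j, {x : G // IsConj (c j) x}) // w₁ p.1 * w₂ p.2 = 1} :=
    have hw (p) : w₁ p =
        (p ⟨0, hg⟩).1 * σ (p ⟨0, hg⟩).2 * (p ⟨0, hg⟩).1⁻¹ * (p ⟨0, hg⟩).2⁻¹ *
          (((List.finRange (n + 1)).drop 1).map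
            (fun i => (p i).1 * (p i).2 * (p i).1⁻¹ * (p i).2⁻¹)).prod := by
      simp [w₁, τ, List.finRange_succ, Function.comp_def]
    { toFun := fun p ↦ ⟨(p.1.1, fun j ↦ ⟨p.1.2 j, p.2.1 j⟩), by rw [hw]; exact p.2.2⟩
      invFun := fun q ↦ ⟨(q.1.1, fun j ↦ q.1.2 j), fun j ↦ (q.1.2 j).2, by
        rw [← hw q.1.1]; exact q.2⟩ }
  have hG : (Fintype.card G : ℂ) ≠ 0 := by simp
  rw [Nat.card_congr e, Nat.card_eq_fintype_card, Fintype.card_subtype, ← mul_right_inj' hG,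
    Finset.card_filter, Nat.cast_sum, Finset.mul_sum]
  simp_rw [Nat.cast_ite, Nat.cast_one, Nat.cast_zero, mul_ite, mul_one, mul_zero,
    ← FDRep.sum_character_one_mul_character V hsimple hdistinct hcomplete]
  rw [Finset.sum_comm, Finset.mul_sum, Finset.mul_sum]
  refine Finset.sum_congr rfl fun i _ ↦ ?_
  have := hsimple i
  have hd := (V i).character_one_ne_zero
  have h₁ := (V i).sum_rho_prod_finRange (fun j (p : G × G) ↦ p.1 * τ j p.2 * p.1⁻¹ * p.2⁻¹) _
    fun j ↦ (V i).sum_rho_twisted_commutator (τ j)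
  have h₂ := (V i).sum_rho_prod_finRange (fun j (x : {x : G // IsConj (c j) x}) ↦ (x : G)) _
    fun j ↦ (V i).sum_rho_conjClass (c j)
  have h₃ : ∑ p : (Fin (n + 1) → G × G) × (∀ j, {x : G // IsConj (c j) x}),
      (V i).ρ (w₁ p.1 * w₂ p.2) = (∑ p, (V i).ρ (w₁ p)) * ∑ q, (V i).ρ (w₂ q) := by
    simp_rw [Fintype.sum_prod_type, map_mul, ← Finset.sum_mul_sum]
  rw [h₁, h₂, smul_mul_smul_comm, mul_one] at h₃
  replace h₃ := congrArg (LinearMap.trace ℂ (V i)) h₃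
  rw [map_sum, map_smul, LinearMap.trace_one, ← FDRep.char_one, smul_eq_mul] at h₃
  rw [← Finset.mul_sum]
  refine (congrArg _ h₃).trans ?_
  rw [Fin.prod_univ_succ]
  simp only [τ, Fin.cons_zero, Fin.cons_succ, MulEquiv.refl_apply, implies_true, if_true,
    Finset.prod_const, Finset.card_univ, Fintype.card_fin]
  split_ifs
  · rw [show 2 * (n + 1) - 2 = 2 * n by omega, pow_mul]
    field_simp
  · simp
end

section
/- Let G be a finite group, σ an automorphism of G, and χ the character of an irreducible finite-dimensional complex representation of G. Then Σ_{(a,b)∈G×G} χ(a·σ(b)·a⁻¹·b⁻¹) equals |G|²/χ(1) if χ∘σ = χ, and equals 0 if χ∘σ ≠ χ. -/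
open CategoryTheory

universe u

namespace FDRep

section Schur

variable {k : Type*} {G : Type*} [Field k] [IsAlgClosed k] [Group G] (V : FDRep k G) [Simple V]

theorem finrank_linHom_invariants_eq_one :
    Module.finrank k (Representation.linHom V.ρ V.ρ).invariants = 1 :=
  (Representation.linHom.invariantsEquivFDRepHom V V).finrank_eq.trans
    (finrank_endomorphism_simple_eq_one k V)

theorem finrank_ne_zero_of_simple : Module.finrank k V ≠ 0 := by
  intro h
  have : Subsingleton V := Module.finrank_zero_iff.mp h
  have h0 : Module.finrank k (Representation.linHom V.ρ V.ρ).invariants = 0 :=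
    Module.finrank_zero_of_subsingleton
  rw [finrank_linHom_invariants_eq_one] at h0
  exact one_ne_zero h0

theorem exists_eq_smul_one_of_commute (f : Module.End k V) (hf : ∀ g, Commute (V.ρ g) f) :
    ∃ c : k, f = c • 1 := by
  have hmem : ∀ f : Module.End k V, (∀ g, Commute (V.ρ g) f) →
      f ∈ (Representation.linHom V.ρ V.ρ).invariants := fun f hf g ↦ by
    change V.ρ g * (f * V.ρ g⁻¹) = f
    rw [← mul_assoc, (hf g).eq, mul_assoc, ← map_mul, mul_inv_cancel, map_one, mul_one]
  have : Nontrivial V :=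
    Module.nontrivial_of_finrank_pos (Nat.pos_of_ne_zero (finrank_ne_zero_of_simple V))
  have hone : (⟨1, hmem 1 fun g ↦ Commute.one_right _⟩ :
      (Representation.linHom V.ρ V.ρ).invariants) ≠ 0 := fun h ↦
    one_ne_zero (congrArg Subtype.val h)
  obtain ⟨c, hc⟩ := (finrank_eq_one_iff_of_nonzero' _ hone).mp
    (finrank_linHom_invariants_eq_one V) ⟨f, hmem f hf⟩
  exact ⟨c, (congrArg Subtype.val hc).symm⟩

end Schur

variable {k : Type*} {G : Type*} [Field k] [IsAlgClosed k] [CharZero k] [Group G] [Fintype G]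

theorem sum_conj_eq_smul_one (V : FDRep k G) [Simple V] (x : G) :
    ∑ a : G, V.ρ (a * x * a⁻¹) =
      ((Fintype.card G : k) * V.character x / V.character 1) • (1 : Module.End k V) := by
  obtain ⟨c, hc⟩ := exists_eq_smul_one_of_commute V (∑ a : G, V.ρ (a * x * a⁻¹)) fun g ↦ by
    rw [commute_iff_eq, Finset.mul_sum, Finset.sum_mul]
    refine Fintype.sum_equiv (Equiv.mulLeft g) _ _ fun a ↦ ?_
    simp only [Equiv.coe_mulLeft, ← map_mul]
    congr 1
    group
  have ht : (Fintype.card G : k) * V.character x = c * V.character 1 := by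
    have h := congrArg (LinearMap.trace k V) hc
    rw [map_sum, map_smul, LinearMap.trace_one, smul_eq_mul] at h
    rw [char_one, ← h]
    change _ = ∑ a : G, V.character (a * x * a⁻¹)
    simp
  have hd : V.character 1 ≠ 0 := by
    rw [char_one]
    exact Nat.cast_ne_zero.mpr (finrank_ne_zero_of_simple V)
  rw [hc, ht, mul_div_cancel_right₀ c hd]

theorem sum_character_conj_mul (V : FDRep k G) [Simple V] (x y : G) :
    ∑ a : G, V.character (a * x * a⁻¹ * y) =
      (Fintype.card G : k) / V.character 1 * (V.character x * V.character y) := by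
  calc ∑ a : G, V.character (a * x * a⁻¹ * y)
      = LinearMap.trace k V ((∑ a : G, V.ρ (a * x * a⁻¹)) * V.ρ y) := by
        rw [Finset.sum_mul, map_sum]
        simp only [character, ← map_mul]
    _ = (Fintype.card G : k) / V.character 1 * (V.character x * V.character y) := by
        rw [sum_conj_eq_smul_one, smul_mul_assoc, one_mul, map_smul, smul_eq_mul]
        change _ * V.character y = _
        ring

open scoped Classical in
theorem sum_character_comp_mul_character_inv {k G : Type u} [Field k] [IsAlgClosed k]
    [CharZero k] [Group G] [Fintype G] (σ : G ≃* G) (V : FDRep k G) [Simple V] :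
    ∑ x : G, V.character (σ x) * V.character x⁻¹ =
      if ∀ x : G, V.character (σ x) = V.character x then (Fintype.card G : k) else 0 := by
  have hσ (x : G) : (of (V.ρ.comp σ.toMonoidHom)).character x = V.character (σ x) := rfl
  have hV : ∑ x : G, V.character x * V.character x⁻¹ = Nat.card G :=
    (simple_iff_char_is_norm_one V).mp inferInstance
  have : Simple (of (V.ρ.comp σ.toMonoidHom)) := by
    rw [simple_iff_char_is_norm_one, ← hV]
    exact Fintype.sum_equiv σ.toEquiv _ _ fun x ↦ by rw [hσ, hσ, map_inv]; rfl
  split_ifs with h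
  · simp_rw [h, hV, Nat.card_eq_fintype_card]
  · have hcard : (Nat.card G : k) ≠ 0 := Nat.cast_ne_zero.mpr Nat.card_pos.ne'
    have := invertibleOfNonzero hcard
    have horth := char_orthonormal (of (V.ρ.comp σ.toMonoidHom)) V
    rw [if_neg fun ⟨i⟩ ↦ h fun x ↦ by rw [← hσ, char_iso i]] at horth
    simp_rw [hσ] at horth
    simpa [hcard] using horth

end FDRep

open scoped Classical in
/-- For the character `χ` of an irreducible complex representation of a finite group `G` and an
automorphism `σ` of `G`, `Σ_{(a,b)} χ(a·σ(b)·a⁻¹·b⁻¹)` equals `|G|²/χ(1)` if `χ∘σ = χ`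
and `0` otherwise. -/
theorem sum_twisted_commutator_char
    {G : Type} [Group G] [Fintype G] (σ : G ≃* G)
    (V : FDRep ℂ G) [Simple V] :
    ∑ a : G, ∑ b : G, V.character (a * σ b * a⁻¹ * b⁻¹)
      = if ∀ x : G, V.character (σ x) = V.character x
        then (Fintype.card G : ℂ) ^ 2 / V.character 1
        else 0 := by
  rw [Finset.sum_comm]
  simp_rw [FDRep.sum_character_conj_mul, ← Finset.mul_sum,
    FDRep.sum_character_comp_mul_character_inv]
  split_ifs
  · ring
  · exact mul_zero _
end

section
/- Let F be a field, n ≥ 1, k ≥ 1, and let a_{j,γ} ∈ Fˣ for 1 ≤ j ≤ k, 1 ≤ γ ≤ n be a generic tuple of eigenvalue data. Let M, M' be positive integers with M + M' ≤ ⌊n/2⌋, and let (𝐀₁,…,𝐀_k,𝐁₁,…,𝐁_k) and (𝐀'₁,…,𝐀'_k,𝐁'₁,…,𝐁'_k) be 2k-tuples of subsets of Λ = {1,…,n} such that |𝐀_j| = |𝐁_j| = M for all j, |𝐀'_j| = |𝐁'_j| = M' for all j, and for each j the four sets 𝐀_j, 𝐁_j, 𝐀'_j, 𝐁'_j are mutually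 disjoint. Then, writing P = [𝐀₁]₁⋯[𝐀_k]_k·[𝐁₁]₁⁻¹⋯[𝐁_k]_k⁻¹ and P' = [𝐀'₁]₁⋯[𝐀'_k]_k·[𝐁'₁]₁⁻¹⋯[𝐁'_k]_k⁻¹, one has P ≠ P' and P ≠ (P')⁻¹. -/
/-- The product of ratios attached to two families of disjoint pairs of finite sets is the product
of ratios attached to the unions. -/
lemma prod_ratio_union {ι α G : Type*} [Fintype ι] [DecidableEq α] [CommGroup G]
    (a : ι → α → G) (A B C D : ι → Finset α)
    (hAC : ∀ j, Disjoint (A j) (C j)) (hBD : ∀ j, Disjoint (B j) (D j)) :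
    (∏ j, (∏ γ ∈ A j ∪ C j, a j γ) * (∏ γ ∈ B j ∪ D j, a j γ)⁻¹) =
      (∏ j, (∏ γ ∈ A j, a j γ) * (∏ γ ∈ B j, a j γ)⁻¹) *
        ∏ j, (∏ γ ∈ C j, a j γ) * (∏ γ ∈ D j, a j γ)⁻¹ := by
  rw [← Finset.prod_mul_distrib]
  refine Finset.prod_congr rfl fun j _ => ?_
  rw [Finset.prod_union (hAC j), Finset.prod_union (hBD j), mul_inv, mul_mul_mul_comm]

/-- Exchanging numerators and denominators inverts the product of ratios. -/
lemma prod_ratio_swap {ι α G : Type*} [Fintype ι] [CommGroup G]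
    (a : ι → α → G) (A B : ι → Finset α) :
    (∏ j, (∏ γ ∈ B j, a j γ) * (∏ γ ∈ A j, a j γ)⁻¹) =
      (∏ j, (∏ γ ∈ A j, a j γ) * (∏ γ ∈ B j, a j γ)⁻¹)⁻¹ := by
  rw [← Finset.prod_inv_distrib]
  exact Finset.prod_congr rfl fun j _ => by rw [mul_inv, inv_inv, mul_comm]

/-- For a generic tuple of eigenvalue data `a : Fin k → Fin n → Fˣ`, positive integers `M, M'`
with `M + M' ≤ ⌊n/2⌋`, and subsets `Aⱼ, Bⱼ` of cardinality `M` and `A'ⱼ, B'ⱼ` of cardinality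
`M'` that are mutually disjoint for each `j`, the products
`P = ∏ⱼ [Aⱼ]ⱼ·[Bⱼ]ⱼ⁻¹` and `P' = ∏ⱼ [A'ⱼ]ⱼ·[B'ⱼ]ⱼ⁻¹` satisfy `P ≠ P'` and `P ≠ P'⁻¹`. -/
theorem generic_distinct_eigenvalue_products
    {F : Type*} [Field F] (n k : ℕ) (hn : 1 ≤ n) (hk : 1 ≤ k)
    (a : Fin k → Fin n → Fˣ)
    (hgen : ∀ M : ℕ, 1 ≤ M → M ≤ n / 2 →
      ∀ A B : Fin k → Finset (Fin n),
        (∀ j, (A j).card = M) → (∀ j, (B j).card = M) →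
        (∀ j, Disjoint (A j) (B j)) →
        (∏ j : Fin k, (∏ γ ∈ A j, a j γ) * (∏ γ ∈ B j, a j γ)⁻¹) ≠ 1)
    (M M' : ℕ) (hM : 0 < M) (hM' : 0 < M') (hMM' : M + M' ≤ n / 2)
    (A B A' B' : Fin k → Finset (Fin n))
    (hA : ∀ j, (A j).card = M) (hB : ∀ j, (B j).card = M)
    (hA' : ∀ j, (A' j).card = M') (hB' : ∀ j, (B' j).card = M')
    (hdisj : ∀ j, Disjoint (A j) (B j) ∧ Disjoint (A j) (A' j) ∧ Disjoint (A j) (B' j) ∧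
      Disjoint (B j) (A' j) ∧ Disjoint (B j) (B' j) ∧ Disjoint (A' j) (B' j)) :
    (∏ j : Fin k, (∏ γ ∈ A j, a j γ) * (∏ γ ∈ B j, a j γ)⁻¹)
        ≠ (∏ j : Fin k, (∏ γ ∈ A' j, a j γ) * (∏ γ ∈ B' j, a j γ)⁻¹) ∧
    (∏ j : Fin k, (∏ γ ∈ A j, a j γ) * (∏ γ ∈ B j, a j γ)⁻¹)
        ≠ (∏ j : Fin k, (∏ γ ∈ A' j, a j γ) * (∏ γ ∈ B' j, a j γ)⁻¹)⁻¹ := by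
  constructor
  · intro h
    refine hgen (M + M') (by omega) hMM' (fun j => A j ∪ B' j) (fun j => B j ∪ A' j)
      (fun j => ?_) (fun j => ?_) (fun j => ?_) ?_
    · rw [Finset.card_union_of_disjoint (hdisj j).2.2.1, hA, hB']
    · rw [Finset.card_union_of_disjoint (hdisj j).2.2.2.1, hB, hA']
    · obtain ⟨hAB, hAA', -, -, hBB', hA'B'⟩ := hdisj j
      simp [Finset.disjoint_union_left, Finset.disjoint_union_right, hAB, hAA', hBB'.symm,
        hA'B'.symm]
    · rw [prod_ratio_union a A B B' A' (fun j => (hdisj j).2.2.1) (fun j => (hdisj j).2.2.2.1),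
        prod_ratio_swap a A' B', h, mul_inv_cancel]
  · intro h
    refine hgen (M + M') (by omega) hMM' (fun j => A j ∪ A' j) (fun j => B j ∪ B' j)
      (fun j => ?_) (fun j => ?_) (fun j => ?_) ?_
    · rw [Finset.card_union_of_disjoint (hdisj j).2.1, hA, hA']
    · rw [Finset.card_union_of_disjoint (hdisj j).2.2.2.2.1, hB, hB']
    · obtain ⟨hAB, -, hAB', hBA', -, hA'B'⟩ := hdisj j
      simp [Finset.disjoint_union_left, Finset.disjoint_union_right, hAB, hAB', hBA'.symm, hA'B']
    · rw [prod_ratio_union a A B A' B' (fun j => (hdisj j).2.1) (fun j => (hdisj j).2.2.2.2.1),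
        h, inv_mul_cancel]
end

section
/- Let G be a finite group and f₁,…,f_m : G → ℂ class functions (functions invariant under conjugation). Define the convolution of two class functions by (f * f')(x) = Σ_{(y,z) : yz = x} f(y)·f'(z). Then (f₁ * f₂ * ⋯ * f_m)(1) = (1/|G|) · Σ_{χ ∈ Irr(G)} χ(1)² · ∏_{i=1}^{m} ( Σ_{h∈G} f_i(h)·χ(h)/χ(1) ), where the sum runs over all irreducible complex characters χ of G. -/
open CategoryTheory

namespace Representation

variable {k G M : Type*} [Field k] [Monoid G] [AddCommGroup M] [Module k M]
  [Module (MonoidAlgebra k G) M] [IsScalarTower k (MonoidAlgebra k G) M]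

theorem asAlgebraHom_ofModule'_apply (r : MonoidAlgebra k G) (x : M) :
    (ofModule' (k := k) (G := G) M).asAlgebraHom r x = r • x :=
  LinearMap.congr_fun (DFunLike.congr_fun
    ((MonoidAlgebra.lift k (M →ₗ[k] M) G).apply_symm_apply (Algebra.lsmul k k M)) r) x

theorem isIrreducible_ofModule' [IsSimpleModule (MonoidAlgebra k G) M] :
    (ofModule' (k := k) (G := G) M).IsIrreducible := by
  rw [irreducible_iff_isSimpleModule_asModule]
  let e : (ofModule' (k := k) (G := G) M).asModule ≃ₗ[MonoidAlgebra k G] M :=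
    { (asModuleEquiv _).toAddEquiv with
      map_smul' := fun r x => by
        change asModuleEquiv _ (r • x) = r • asModuleEquiv _ x
        rw [asModuleEquiv_map_smul, asAlgebraHom_ofModule'_apply] }
  exact IsSimpleModule.congr e

end Representation

namespace FDRep

variable {G : Type} [Group G] [Fintype G]

/-- The operator `∑ g, F g • ρ g` by which a function `F` on `G` acts on a representation. -/
noncomputable def groupFunctionAction (V : FDRep ℂ G) (F : G → ℂ) : V →ₗ[ℂ] V :=
  ∑ g : G, F g • V.ρ g

theorem trace_groupFunctionAction (V : FDRep ℂ G) (F : G → ℂ) :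
    LinearMap.trace ℂ V (V.groupFunctionAction F) = ∑ g : G, F g * V.character g := by
  simp only [groupFunctionAction, map_sum, map_smul, smul_eq_mul]
  rfl

theorem groupFunctionAction_delta [DecidableEq G] (V : FDRep ℂ G) :
    V.groupFunctionAction (fun x => if x = 1 then 1 else 0) = 1 := by
  simp [groupFunctionAction]

theorem groupFunctionAction_convolution (V : FDRep ℂ G) (u v : G → ℂ) :
    V.groupFunctionAction (fun x => ∑ y : G, u y * v (y⁻¹ * x)) =
      V.groupFunctionAction u * V.groupFunctionAction v := by
  simp only [groupFunctionAction, Finset.sum_smul, Finset.sum_mul_sum]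
  rw [Finset.sum_comm]
  refine Finset.sum_congr rfl fun y _ => ?_
  rw [← Equiv.sum_comp (Equiv.mulLeft y)]
  refine Finset.sum_congr rfl fun z _ => ?_
  simp [map_mul, smul_smul, mul_comm]

theorem groupFunctionAction_comm (V : FDRep ℂ G) {F : G → ℂ}
    (hF : ∀ g x : G, F (g * x * g⁻¹) = F x) (g : G) :
    V.groupFunctionAction F * V.ρ g = V.ρ g * V.groupFunctionAction F := by
  simp only [groupFunctionAction, Finset.sum_mul, Finset.mul_sum]
  rw [← Equiv.sum_comp (MulAut.conj g).toEquiv]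
  refine Finset.sum_congr rfl fun x _ => ?_
  simp [hF, ← map_mul]

theorem exists_groupFunctionAction_eq_smul_one (V : FDRep ℂ G) [Simple V] {F : G → ℂ}
    (hF : ∀ g x : G, F (g * x * g⁻¹) = F x) :
    ∃ c : ℂ, V.groupFunctionAction F = c • 1 := by
  let T : V ⟶ V := ⟨InducedCategory.homMk (ModuleCat.ofHom (V.groupFunctionAction F)), fun g => by
    ext v
    exact LinearMap.congr_fun (V.groupFunctionAction_comm hF g) v⟩
  obtain ⟨c, hc⟩ := endomorphism_simple_eq_smul_id ℂ T
  refine ⟨c, ?_⟩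
  have h : (c • 𝟙 V : V ⟶ V).hom.hom.hom = V.groupFunctionAction F :=
    congrArg (fun S : V ⟶ V => S.hom.hom.hom) hc
  exact h.symm

theorem character_one_ne_zero_s8 (V : FDRep ℂ G) [hV : Simple V] : V.character 1 ≠ 0 := by
  intro h
  rw [char_one, Nat.cast_eq_zero] at h
  have hs : Subsingleton V := Module.finrank_zero_iff.mp h
  have hz : ∀ g, V.character g = 0 := fun g => by
    have : V.ρ g = 0 := Subsingleton.elim _ _
    change LinearMap.trace ℂ V (V.ρ g) = 0
    rw [this, map_zero]
  have := V.simple_iff_char_is_norm_one.mp hV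
  simp [hz, eq_comm] at this

theorem groupFunctionAction_eq_smul_one (V : FDRep ℂ G) [Simple V] {F : G → ℂ}
    (hF : ∀ g x : G, F (g * x * g⁻¹) = F x) :
    V.groupFunctionAction F = (∑ h : G, F h * V.character h / V.character 1) • 1 := by
  obtain ⟨c, hc⟩ := V.exists_groupFunctionAction_eq_smul_one hF
  have ht := V.trace_groupFunctionAction F
  rw [hc, map_smul, LinearMap.trace_one, ← char_one, smul_eq_mul] at ht
  rw [hc, ← Finset.sum_div, ← ht, mul_div_cancel_right₀ _ V.character_one_ne_zero_s8]

theorem groupFunctionAction_foldr_convolution [DecidableEq G] (V : FDRep ℂ G) [Simple V]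
    (l : List (G → ℂ)) (hl : ∀ F ∈ l, ∀ g x : G, F (g * x * g⁻¹) = F x) :
    V.groupFunctionAction (l.foldr (fun u v x => ∑ y : G, u y * v (y⁻¹ * x))
        (fun x => if x = 1 then 1 else 0)) =
      (l.map fun F => ∑ h : G, F h * V.character h / V.character 1).prod • 1 := by
  induction l with
  | nil => simpa using V.groupFunctionAction_delta
  | cons F l ih =>
    rw [List.foldr_cons, groupFunctionAction_convolution,
      ih fun F' hF' => hl F' (List.mem_cons_of_mem _ hF'),
      V.groupFunctionAction_eq_smul_one (hl F List.mem_cons_self), List.map_cons, List.prod_cons,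
      smul_mul_smul_comm, one_mul]

theorem simple_of_isIrreducible_s8 {W : Type} [AddCommGroup W] [Module ℂ W] [FiniteDimensional ℂ W]
    (ρ : Representation ℂ G W) [ρ.IsIrreducible] : Simple (FDRep.of ρ) := by
  rw [simple_iff_char_is_norm_one]
  have h0 : (Nat.card G : ℂ) ≠ 0 := NeZero.ne _
  have := invertibleOfNonzero h0
  have h := Representation.char_orthonormal ρ ρ
  rw [if_pos ⟨Representation.Equiv.refl ρ⟩, inv_mul_eq_one₀ h0] at h
  exact h.symm

theorem groupFunctionAction_of_iso {V W : FDRep ℂ G} (e : V ≅ W) {F : G → ℂ}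
    (h : V.groupFunctionAction F = 0) : W.groupFunctionAction F = 0 := by
  have : W.groupFunctionAction F = (isoToLinearEquiv e).conj (V.groupFunctionAction F) := by
    simp only [groupFunctionAction, map_sum, map_smul, Iso.conj_ρ e]
  rw [this, h, map_zero]

theorem sum_single_smul_eq_zero {F : G → ℂ}
    (hF : ∀ W : FDRep ℂ G, Simple W → W.groupFunctionAction F = 0) {M : Type} [AddCommGroup M]
    [Module ℂ M] [Module (MonoidAlgebra ℂ G) M] [IsScalarTower ℂ (MonoidAlgebra ℂ G) M]
    [IsSimpleModule (MonoidAlgebra ℂ G) M] (x : M) :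
    (∑ g : G, MonoidAlgebra.single g (F g)) • x = 0 := by
  have := Representation.isIrreducible_ofModule' (k := ℂ) (G := G) (M := M)
  have : FiniteDimensional ℂ M := Module.Finite.trans (MonoidAlgebra ℂ G) M
  rw [← Representation.asAlgebraHom_ofModule'_apply (k := ℂ)]
  have h := hF _ (simple_of_isIrreducible_s8 (Representation.ofModule' (k := ℂ) (G := G) M))
  simp only [map_sum, Representation.asAlgebraHom_single]
  exact LinearMap.congr_fun h x

/-- A function on `G` acting by zero on every simple representation vanishes: as an element of the
group algebra it lies in the Jacobson radical, which is zero by Maschke's theorem. -/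
theorem eq_zero_of_groupFunctionAction_eq_zero {F : G → ℂ}
    (hF : ∀ W : FDRep ℂ G, Simple W → W.groupFunctionAction F = 0) : F = 0 := by
  let a : MonoidAlgebra ℂ G := ∑ g : G, MonoidAlgebra.single g (F g)
  have ha : a ∈ Ring.jacobson (MonoidAlgebra ℂ G) := by
    refine Ideal.mem_sInf.mpr fun {I} hI => ?_
    have : IsSimpleModule (MonoidAlgebra ℂ G) (MonoidAlgebra ℂ G ⧸ I) :=
      isSimpleModule_iff_isCoatom.mpr hI
    have h := sum_single_smul_eq_zero hF (Submodule.Quotient.mk (p := I) 1)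
    rwa [← Submodule.Quotient.mk_smul, smul_eq_mul, mul_one, Submodule.Quotient.mk_eq_zero] at h
  rw [IsSemisimpleRing.jacobson_eq_bot, Ideal.mem_bot] at ha
  funext g
  have := congrArg (fun b : MonoidAlgebra ℂ G => b.coeff g) ha
  classical
  simpa [a, Finsupp.single_apply] using this

variable {ι : Type} [Fintype ι] (V : ι → FDRep ℂ G)

/-- The decomposition of the regular character into irreducible characters. -/
theorem sum_character_one_mul_character_s8 [DecidableEq G]
    (hsimple : ∀ i, Simple (V i))
    (hdistinct : ∀ i j : ι, Nonempty (V i ≅ V j) → i = j)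
    (hcomplete : ∀ W : FDRep ℂ G, Simple W → ∃ i : ι, Nonempty (V i ≅ W)) (x : G) :
    ∑ i : ι, (V i).character 1 * (V i).character x =
      if x = 1 then (Fintype.card G : ℂ) else 0 := by
  classical
  let F : G → ℂ := fun x => (if x = 1 then (Fintype.card G : ℂ) else 0) -
    ∑ i : ι, (V i).character 1 * (V i).character x⁻¹
  have hconj : ∀ g x : G, F (g * x * g⁻¹) = F x := fun g x => by
    have h (i : ι) : (V i).character (g * x * g⁻¹)⁻¹ = (V i).character x⁻¹ := by
      rw [show (g * x * g⁻¹)⁻¹ = g * x⁻¹ * g⁻¹ by group, char_conj]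
    simp only [F, h, conj_eq_one_iff]
  have h0 : (Nat.card G : ℂ) ≠ 0 := NeZero.ne _
  have := invertibleOfNonzero h0
  have horth (i j : ι) : ∑ g : G, (V j).character g * (V i).character g⁻¹ =
      if j = i then (Nat.card G : ℂ) else 0 := by
    have := hsimple
    have h := char_orthonormal (V j) (V i)
    rw [inv_mul_eq_iff_eq_mul₀ h0] at h
    rw [h]
    by_cases hij : j = i
    · subst hij
      simp [Nonempty.intro (Iso.refl (V j))]
    · rw [if_neg fun h => hij (hdistinct j i h), if_neg hij, mul_zero]
  have hsum (j : ι) : ∑ g : G, F g * (V j).character g = 0 := by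
    have h : ∑ g : G, (∑ i : ι, (V i).character 1 * (V i).character g⁻¹) * (V j).character g =
        (V j).character 1 * Nat.card G := by
      simp only [Finset.sum_mul]
      rw [Finset.sum_comm]
      simp only [mul_assoc, ← Finset.mul_sum, mul_comm ((V _).character _⁻¹), horth]
      simp
    simp only [F, sub_mul, Finset.sum_sub_distrib, h]
    simp [mul_comm]
  have hzero : F = 0 := eq_zero_of_groupFunctionAction_eq_zero fun W hW => by
    obtain ⟨j, ⟨e⟩⟩ := hcomplete W hW
    have := hsimple j
    refine groupFunctionAction_of_iso e ?_
    rw [(V j).groupFunctionAction_eq_smul_one hconj, ← Finset.sum_div, hsum, zero_div, zero_smul]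
  have h := sub_eq_zero.mp (congrFun hzero x⁻¹)
  simpa only [inv_inv, inv_eq_one] using h.symm

end FDRep

/-- For class functions `f₁,…,f_m : G → ℂ` on a finite group `G`, the iterated convolution
`(f₁ * ⋯ * f_m)(1)` (with convolution `(f*f')(x) = Σ_{yz=x} f(y)f'(z)`, realized as a fold
against the delta function at `1`, which is the convolution identity) equals
`(1/|G|)·Σ_χ χ(1)²·∏ᵢ (Σ_h fᵢ(h)χ(h)/χ(1))`, the sum being over the irreducible complex
characters of `G`, encoded by a complete family `(V i)` of pairwise non-isomorphic simple
objects of `FDRep ℂ G`. -/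
theorem convolution_at_one_eq_character_sum
    {G : Type} [Group G] [Fintype G] [DecidableEq G]
    (m : ℕ) (f : Fin m → G → ℂ)
    (hclass : ∀ (i : Fin m) (g x : G), f i (g * x * g⁻¹) = f i x)
    (ι : Type) [Fintype ι] (V : ι → FDRep ℂ G)
    (hsimple : ∀ i, Simple (V i))
    (hdistinct : ∀ i j : ι, Nonempty (V i ≅ V j) → i = j)
    (hcomplete : ∀ W : FDRep ℂ G, Simple W → ∃ i : ι, Nonempty (V i ≅ W)) :
    (List.ofFn f).foldr (fun u v x => ∑ y : G, u y * v (y⁻¹ * x))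
        (fun x => if x = 1 then 1 else 0) 1
      = (1 / (Fintype.card G : ℂ)) *
          ∑ i : ι, ((V i).character 1) ^ 2 *
            ∏ j : Fin m, ∑ h : G, f j h * (V i).character h / (V i).character 1 := by
  classical
  set P := (List.ofFn f).foldr (fun u v x => ∑ y : G, u y * v (y⁻¹ * x))
    (fun x => if x = 1 then 1 else 0)
  have hP (i : ι) : ∑ g : G, P g * (V i).character g = (V i).character 1 *
      ∏ j : Fin m, ∑ h : G, f j h * (V i).character h / (V i).character 1 := by
    have := hsimple i
    rw [← FDRep.trace_groupFunctionAction,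
      (V i).groupFunctionAction_foldr_convolution _ fun F hF => by
        obtain ⟨j, rfl⟩ := (List.mem_ofFn' f F).mp hF
        exact hclass j,
      map_smul, LinearMap.trace_one, ← FDRep.char_one, List.map_ofFn, List.prod_ofFn, smul_eq_mul,
      mul_comm]
    rfl
  have hreg := FDRep.sum_character_one_mul_character_s8 V hsimple hdistinct hcomplete
  have hcard : (Fintype.card G : ℂ) ≠ 0 := Nat.cast_ne_zero.mpr Fintype.card_ne_zero
  calc P 1 = 1 / (Fintype.card G : ℂ) *
        ∑ g : G, P g * ∑ i : ι, (V i).character 1 * (V i).character g := by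
        simp only [hreg]
        simp
        field_simp
    _ = _ := by
        congr 1
        simp only [Finset.mul_sum]
        rw [Finset.sum_comm]
        refine Finset.sum_congr rfl fun i _ => ?_
        rw [sq, mul_assoc, ← hP i, Finset.mul_sum]
        exact Finset.sum_congr rfl fun g _ => by ring
end
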